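/- arXiv:1301.6090 — 2 statements merged into one kernel-verified Lean document; each statement's English description precedes it below -/
import Mathlib

section
/- The operator W := ∑_{j=0}^{N−1} V^{kj} · E_j is unitary, and for every x ∈ M and every x′ in the commutant M′ of M, the operator x commutes with W x′ W*, i.e. x · (W x′ W*) = (W x′ W*) · x. -/
noncomputable section

/-- If the `e j` are mutually orthogonal projections commuting with `x` and `e j` commutes with
`u j`, then conjugation of `x` by `∑ j, u j * e j` is block diagonal. -/
theorem sum_mul_mul_mul_star_sum {ι A : Type*} [Ring A] [StarRing A] (s : Finset ι)
    (u e : ι → A) (x : A) (hsa : ∀ j ∈ s, star (e j) = e j) (hidem : ∀ j ∈ s, e j * e j = e j)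
    (horth : ∀ j ∈ s, ∀ l ∈ s, j ≠ l → e j * e l = 0)
    (hu : ∀ j ∈ s, Commute (e j) (u j)) (hx : ∀ j ∈ s, Commute (e j) x) :
    (∑ j ∈ s, u j * e j) * x * star (∑ j ∈ s, u j * e j)
      = ∑ j ∈ s, u j * x * star (u j) * e j := by
  rw [star_sum, Finset.sum_mul, Finset.sum_mul]
  refine Finset.sum_congr rfl fun j hj => ?_
  rw [Finset.mul_sum, Finset.sum_eq_single_of_mem j hj]
  · have hu' : e j * star (u j) = star (u j) * e j := by
      simpa [hsa j hj] using congrArg star (hu j hj).eq.symm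
    calc u j * e j * x * star (u j * e j)
        = u j * (e j * x) * (e j * star (u j)) := by
          rw [star_mul, hsa j hj]; simp only [mul_assoc]
      _ = u j * x * (e j * e j * star (u j)) := by
          rw [(hx j hj).eq]; simp only [mul_assoc]
      _ = u j * x * star (u j) * e j := by
          rw [hidem j hj, hu']; simp only [mul_assoc]
  · intro l hl hlj
    calc u j * e j * x * star (u l * e l)
        = u j * (e j * x) * (e l * star (u l)) := by
          rw [star_mul, hsa l hl]; simp only [mul_assoc]
      _ = u j * x * (e j * e l * star (u l)) := by
          rw [(hx j hj).eq]; simp only [mul_assoc]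
      _ = 0 := by rw [horth j hj l hl hlj.symm, zero_mul, mul_zero]

/-- A combination of unitaries along a partition of unity by commuting projections is unitary. -/
theorem sum_mul_mem_unitary {ι A : Type*} [Ring A] [StarRing A] (s : Finset ι)
    (u : ι → unitary A) (e : ι → A) (hsa : ∀ j ∈ s, star (e j) = e j)
    (hidem : ∀ j ∈ s, e j * e j = e j) (horth : ∀ j ∈ s, ∀ l ∈ s, j ≠ l → e j * e l = 0)
    (hsum : ∑ j ∈ s, e j = 1) (hu : ∀ j ∈ s, Commute (e j) (u j : A)) :
    ∑ j ∈ s, (u j : A) * e j ∈ unitary A := by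
  have hu' : ∀ j ∈ s, Commute (e j) (star (u j : A)) := fun j hj => by
    simpa [hsa j hj] using (hu j hj).star_star
  have hstar : star (∑ j ∈ s, (u j : A) * e j) = ∑ j ∈ s, star (u j : A) * e j := by
    rw [star_sum]
    exact Finset.sum_congr rfl fun j hj => by rw [star_mul, hsa j hj, (hu' j hj).eq]
  rw [Unitary.mem_iff]
  constructor
  · have h := sum_mul_mul_mul_star_sum s (fun j => star (u j : A)) e 1 hsa hidem horth hu'
      fun j _ => Commute.one_right (e j)
    rw [← hstar] at h
    simpa [hsum] using h
  · have h := sum_mul_mul_mul_star_sum s (fun j => (u j : A)) e 1 hsa hidem horth hu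
      fun j _ => Commute.one_right (e j)
    simpa [hsum] using h

/-- If conjugation by a unitary `V` maps a set onto itself, then conjugation by any integer power
of `V` maps the set into itself. -/
theorem zpow_mul_mul_star_mem {A : Type*} [Ring A] [StarRing A] (V : unitary A) {S : Set A}
    (hS : (fun y => (V : A) * y * star (V : A)) '' S = S) (n : ℤ) :
    ∀ y ∈ S, ((V ^ n : unitary A) : A) * y * star ((V ^ n : unitary A) : A) ∈ S := by
  refine zpow_induction_right
    (P := fun W : unitary A => ∀ y ∈ S, (W : A) * y * star (W : A) ∈ S) ?_ ?_ ?_ n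
  · intro y hy
    simpa using hy
  · intro W hW y hy
    have h := hW _ (hS.subset ⟨y, hy, rfl⟩)
    simpa [mul_assoc] using h
  · intro W hW y hy
    obtain ⟨z, hz, rfl⟩ := hS.superset hy
    have h : star (V : A) * ((V : A) * z * star (V : A)) * (V : A) = z := by
      rw [← mul_assoc, ← mul_assoc, Unitary.coe_star_mul_self, one_mul, mul_assoc,
        Unitary.coe_star_mul_self, mul_one]
    have h' := hW z hz
    rw [← h] at h'
    simpa only [← Unitary.star_eq_inv, Submonoid.coe_mul, Unitary.coe_star, star_mul, star_star,
      mul_assoc] using h'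

/-- Twisted-commutativity for a `ℤ_N` inner symmetry: given a unitary `V` with
`V^N = 1` whose conjugation preserves the von Neumann algebra `M`, and a family
of mutually orthogonal projections `E_j` summing to `1`, each commuting with `V`,
`M` and `M′`, the twist `W := ∑_j V^{kj} E_j` is unitary and every `x ∈ M`
commutes with `W x′ W*` for all `x′ ∈ M′`. -/
theorem twist_unitary_and_commutes
    {H : Type*} [NormedAddCommGroup H] [InnerProductSpace ℂ H] [CompleteSpace H]
    (N : ℕ) (hN : 0 < N) (k : ℤ)
    (V : unitary (H →L[ℂ] H)) (hVN : V ^ N = 1)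
    (M : VonNeumannAlgebra H)
    (hM : (fun y => (V : H →L[ℂ] H) * y * star (V : H →L[ℂ] H)) '' (M : Set (H →L[ℂ] H))
        = (M : Set (H →L[ℂ] H)))
    (E : ℕ → (H →L[ℂ] H))
    (hEsa : ∀ j < N, star (E j) = E j)
    (hEidem : ∀ j < N, E j * E j = E j)
    (hEorth : ∀ j < N, ∀ l < N, j ≠ l → E j * E l = 0)
    (hEsum : ∑ j ∈ Finset.range N, E j = 1)
    (hEV : ∀ j < N, E j * (V : H →L[ℂ] H) = (V : H →L[ℂ] H) * E j)
    (hEM : ∀ j < N, ∀ y ∈ M, E j * y = y * E j)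
    (hEM' : ∀ j < N, ∀ y ∈ M.commutant, E j * y = y * E j) :
    (∑ j ∈ Finset.range N, ((V ^ (k * (j : ℤ)) : unitary (H →L[ℂ] H)) : H →L[ℂ] H) * E j)
      ∈ unitary (H →L[ℂ] H) ∧
    ∀ x ∈ M, ∀ x' ∈ M.commutant,
      x * ((∑ j ∈ Finset.range N, ((V ^ (k * (j : ℤ)) : unitary (H →L[ℂ] H)) : H →L[ℂ] H) * E j)
            * x' *
            star (∑ j ∈ Finset.range N, ((V ^ (k * (j : ℤ)) : unitary (H →L[ℂ] H)) : H →L[ℂ] H) * E j))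
        = ((∑ j ∈ Finset.range N, ((V ^ (k * (j : ℤ)) : unitary (H →L[ℂ] H)) : H →L[ℂ] H) * E j)
            * x' *
            star (∑ j ∈ Finset.range N, ((V ^ (k * (j : ℤ)) : unitary (H →L[ℂ] H)) : H →L[ℂ] H) * E j)) * x := by
  have hEU : ∀ j ∈ Finset.range N,
      Commute (E j) ((V ^ (k * (j : ℤ)) : unitary (H →L[ℂ] H)) : H →L[ℂ] H) := by
    intro j hj
    have hc : Commute (E j) (V : H →L[ℂ] H) := hEV j (Finset.mem_range.1 hj)
    have h := hc.units_zpow_right (u := Unitary.toUnits V) (k * (j : ℤ))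
    rwa [← map_zpow] at h
  simp only [← Finset.mem_range] at hEsa hEidem hEorth hEM hEM'
  refine ⟨sum_mul_mem_unitary _ (fun j : ℕ => V ^ (k * (j : ℤ))) E hEsa hEidem hEorth hEsum hEU,
    fun x hx x' hx' => ?_⟩
  rw [sum_mul_mul_mul_star_sum _ _ E x' hEsa hEidem hEorth hEU fun j hj => hEM' j hj x' hx']
  refine Commute.sum_right _ _ _ fun j hj => Commute.mul_right ?_ (hEM j hj x hx).symm
  set U : unitary (H →L[ℂ] H) := V ^ (k * (j : ℤ)) with hU
  have hmem : star (U : H →L[ℂ] H) * x * (U : H →L[ℂ] H) ∈ M := by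
    have h := zpow_mul_mul_star_mem V hM (-(k * (j : ℤ))) x hx
    rw [zpow_neg, ← hU, ← Unitary.star_eq_inv, Unitary.coe_star, star_star] at h
    exact h
  have hcomm := VonNeumannAlgebra.mem_commutant_iff.1 hx' _ hmem
  have h := congrArg (fun z => (U : H →L[ℂ] H) * z * star (U : H →L[ℂ] H)) hcomm
  have hUs : (U : H →L[ℂ] H) * star (U : H →L[ℂ] H) = 1 := Unitary.mul_star_self_of_mem U.2
  have hUU : ∀ z : H →L[ℂ] H, (U : H →L[ℂ] H) * (star (U : H →L[ℂ] H) * z) = z := fun z => by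
    rw [← mul_assoc, hUs, one_mul]
  simpa only [Commute, SemiconjBy, mul_assoc, hUU, hUs, mul_one] using h
end
end

section
/- For any integer k and any x ∈ B(H), defining τ_k(x) := ∑_{l=0}^{N−1} ∑_{m=0}^{N−1} x_{l,m} · U₁^{k m}, one has the norm estimate ‖x‖ ≤ N² · ‖τ_k(x)‖. (In particular the linear map τ_k is injective with inverse bounded by N².) -/
noncomputable section

variable {H : Type*} [NormedAddCommGroup H] [InnerProductSpace ℂ H] [CompleteSpace H]

/-- `ω = exp(2πi/N)`. -/
def omegaN (N : ℕ) : ℂ := Complex.exp (2 * Real.pi * Complex.I / N)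

/-- The two-variable Fourier component
`x_{l,m} = (1/N²) ∑_{j₁,j₂} ω^{-(j₁l+j₂m)} U₁^{j₁} U₂^{j₂} x (U₂*)^{j₂} (U₁*)^{j₁}`. -/
def fourierComp2 (N : ℕ) (U₁ U₂ x : H →L[ℂ] H) (l m : ℕ) : H →L[ℂ] H :=
  (1 / (N : ℂ) ^ 2) • ∑ j₁ ∈ Finset.range N, ∑ j₂ ∈ Finset.range N,
    (omegaN N) ^ (-(j₁ * l + j₂ * m : ℤ)) •
      (U₁ ^ j₁ * U₂ ^ j₂ * x * (star U₂) ^ j₂ * (star U₁) ^ j₁)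

/-- The sum of the powers of a nontrivial `N`-th root of unity vanishes. -/
lemma geom_sum_eq_zero_of_pow_eq_one {K : Type*} [Field K] {z : K} {N : ℕ}
    (hz : z ^ N = 1) (hz1 : z ≠ 1) : ∑ i ∈ Finset.range N, z ^ i = 0 := by
  rw [geom_sum_eq hz1, hz, sub_self, zero_div]

section CyclicProjection

variable {K M : Type*} [Field K] [AddCommGroup M] [Module K M]

/-- The projection onto the `ζ ^ m`-eigenspace of an operator `φ` with `φ ^ N = 1`. -/
def cyclicProj (ζ : K) (N : ℕ) (φ : Module.End K M) (m : ℕ) : Module.End K M :=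
  (N : K)⁻¹ • ∑ j ∈ Finset.range N, ((ζ⁻¹) ^ m) ^ j • φ ^ j

variable {ζ : K} {N : ℕ} {φ : Module.End K M}

lemma mul_cyclicProj (hζ : IsPrimitiveRoot ζ N) (hN : 0 < N) (hφ : φ ^ N = 1) (m : ℕ) :
    φ * cyclicProj ζ N φ m = ζ ^ m • cyclicProj ζ N φ m := by
  have hζ0 : ζ ≠ 0 := hζ.ne_zero hN.ne'
  have hz : ((ζ⁻¹) ^ m) ^ N = 1 := by
    rw [← pow_mul, mul_comm, pow_mul, inv_pow, hζ.pow_eq_one, inv_one, one_pow]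
  have hshift : ∑ j ∈ Finset.range N, ((ζ⁻¹) ^ m) ^ (j + 1) • φ ^ (j + 1) =
      ∑ j ∈ Finset.range N, ((ζ⁻¹) ^ m) ^ j • φ ^ j := by
    have h := (Finset.sum_range_succ' (fun j => ((ζ⁻¹) ^ m) ^ j • φ ^ j) N).symm.trans
      (Finset.sum_range_succ (fun j => ((ζ⁻¹) ^ m) ^ j • φ ^ j) N)
    rw [hz, hφ, pow_zero, pow_zero] at h
    exact add_right_cancel h
  rw [cyclicProj, mul_smul_comm, smul_comm (ζ ^ m)]
  congr 1
  conv_rhs => rw [← hshift]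
  rw [Finset.mul_sum, Finset.smul_sum]
  refine Finset.sum_congr rfl fun j _ => ?_
  rw [mul_smul_comm, smul_smul, ← pow_succ', pow_succ' ((ζ⁻¹) ^ m), ← mul_assoc, ← mul_pow,
    mul_inv_cancel₀ hζ0, one_pow, one_mul]

lemma pow_mul_cyclicProj (hζ : IsPrimitiveRoot ζ N) (hN : 0 < N) (hφ : φ ^ N = 1) (m j : ℕ) :
    φ ^ j * cyclicProj ζ N φ m = (ζ ^ m) ^ j • cyclicProj ζ N φ m := by
  induction j with
  | zero => simp
  | succ j ih =>
    rw [pow_succ, mul_assoc, mul_cyclicProj hζ hN hφ, mul_smul_comm, ih, smul_smul, ← pow_succ']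

lemma cyclicProj_mul_self [CharZero K] (hζ : IsPrimitiveRoot ζ N) (hN : 0 < N) (hφ : φ ^ N = 1)
    (m : ℕ) : cyclicProj ζ N φ m * cyclicProj ζ N φ m = cyclicProj ζ N φ m := by
  have hζ0 : ζ ≠ 0 := hζ.ne_zero hN.ne'
  have hN0 : (N : K) ≠ 0 := Nat.cast_ne_zero.2 hN.ne'
  nth_rewrite 1 [cyclicProj]
  simp only [smul_mul_assoc, Finset.sum_mul, pow_mul_cyclicProj hζ hN hφ, smul_smul, ← mul_pow,
    inv_mul_cancel₀ hζ0, one_pow, one_smul, Finset.sum_const, Finset.card_range]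
  rw [← Nat.cast_smul_eq_nsmul K, smul_smul, inv_mul_cancel₀ hN0, one_smul]

lemma cyclicProj_mul_of_ne (hζ : IsPrimitiveRoot ζ N) (hφ : φ ^ N = 1)
    {m n : ℕ} (hm : m < N) (hn : n < N) (hmn : n ≠ m) :
    cyclicProj ζ N φ n * cyclicProj ζ N φ m = 0 := by
  have hN : 0 < N := hm.pos
  have hζ0 : ζ ≠ 0 := hζ.ne_zero hN.ne'
  have hsum : ∑ j ∈ Finset.range N, ((ζ⁻¹) ^ n * ζ ^ m) ^ j = 0 := by
    apply geom_sum_eq_zero_of_pow_eq_one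
    · rw [mul_pow, ← pow_mul, ← pow_mul, mul_comm n, mul_comm m, pow_mul, pow_mul, inv_pow,
        hζ.pow_eq_one, inv_one, one_pow, one_pow, one_mul]
    · rw [inv_pow, inv_mul_eq_div]
      intro h
      exact hmn (hζ.pow_inj hm hn ((div_eq_one_iff_eq (pow_ne_zero _ hζ0)).1 h)).symm
  nth_rewrite 1 [cyclicProj]
  simp only [smul_mul_assoc, Finset.sum_mul, pow_mul_cyclicProj hζ hN hφ, smul_smul, ← mul_pow]
  rw [← Finset.sum_smul, hsum, zero_smul, smul_zero]

lemma sum_inv_pow_pow (hζ : IsPrimitiveRoot ζ N) {j : ℕ} (hj : j < N) :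
    ∑ m ∈ Finset.range N, ((ζ⁻¹) ^ m) ^ j = if j = 0 then (N : K) else 0 := by
  split_ifs with h
  · simp [h]
  · simp only [← pow_mul, mul_comm _ j]
    simp only [pow_mul]
    apply geom_sum_eq_zero_of_pow_eq_one
    · rw [← pow_mul, mul_comm, pow_mul, inv_pow, hζ.pow_eq_one, inv_one, one_pow]
    · exact hζ.inv.pow_ne_one_of_pos_of_lt h hj

lemma sum_cyclicProj [CharZero K] (hζ : IsPrimitiveRoot ζ N) (hN : 0 < N) :
    ∑ m ∈ Finset.range N, cyclicProj ζ N φ m = 1 := by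
  have hN0 : (N : K) ≠ 0 := Nat.cast_ne_zero.2 hN.ne'
  simp only [cyclicProj]
  rw [← Finset.smul_sum, Finset.sum_comm]
  simp only [← Finset.sum_smul]
  rw [Finset.sum_congr rfl fun j hj => by rw [sum_inv_pow_pow hζ (Finset.mem_range.1 hj)]]
  simp [hN.ne', smul_smul, hN0]

lemma Commute.cyclicProj_right {T : Module.End K M} (h : Commute T φ) (m : ℕ) :
    Commute T (cyclicProj ζ N φ m) :=
  (Commute.sum_right _ _ _ fun j _ => (h.pow_right j).smul_right _).smul_right _

end CyclicProjection

lemma norm_cyclicProj_apply_le {E : Type*} [NormedAddCommGroup E] [NormedSpace ℂ E]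
    {ζ : ℂ} {N : ℕ} {φ : Module.End ℂ E} (hζ : IsPrimitiveRoot ζ N) (hN : 0 < N)
    (hφ : ∀ y, ‖φ y‖ = ‖y‖) (m : ℕ) (y : E) : ‖cyclicProj ζ N φ m y‖ ≤ ‖y‖ := by
  have hpow : ∀ j : ℕ, ‖(φ ^ j) y‖ = ‖y‖ := fun j => by
    induction j with
    | zero => simp
    | succ j ih => rw [pow_succ', Module.End.mul_apply, hφ, ih]
  have hζ1 : ‖ζ‖ = 1 := hζ.norm'_eq_one hN.ne'
  have hN0 : (N : ℝ) ≠ 0 := Nat.cast_ne_zero.2 hN.ne'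
  rw [cyclicProj, LinearMap.smul_apply, norm_smul, LinearMap.sum_apply]
  calc ‖(N : ℂ)⁻¹‖ * ‖∑ j ∈ Finset.range N, (((ζ⁻¹) ^ m) ^ j • φ ^ j) y‖
      ≤ (N : ℝ)⁻¹ * ∑ j ∈ Finset.range N, ‖(((ζ⁻¹) ^ m) ^ j • φ ^ j) y‖ := by
        rw [norm_inv, Complex.norm_natCast]
        gcongr
        exact norm_sum_le _ _
    _ = ‖y‖ := by
        simp [norm_smul, hζ1, hpow, hN0]

/-- Summing the eigencomponents twisted by isometries commuting with `φ` shrinks the norm by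
at most a factor `N`. -/
lemma norm_le_mul_norm_sum_comp_cyclicProj {E : Type*} [NormedAddCommGroup E] [NormedSpace ℂ E]
    {ζ : ℂ} {N : ℕ} {φ : Module.End ℂ E} (hζ : IsPrimitiveRoot ζ N) (hN : 0 < N)
    (hφN : φ ^ N = 1) (hφ : ∀ y, ‖φ y‖ = ‖y‖) {T : ℕ → Module.End ℂ E}
    (hTφ : ∀ m, Commute (T m) φ) (hT : ∀ m y, ‖T m y‖ = ‖y‖) (x : E) :
    ‖x‖ ≤ N * ‖∑ m ∈ Finset.range N, T m (cyclicProj ζ N φ m x)‖ := by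
  set t := ∑ m ∈ Finset.range N, T m (cyclicProj ζ N φ m x) with ht
  have hcomp : ∀ n ∈ Finset.range N, cyclicProj ζ N φ n t = T n (cyclicProj ζ N φ n x) := by
    intro n hn
    have hswap : ∀ m, cyclicProj ζ N φ n (T m (cyclicProj ζ N φ m x)) =
        T m ((cyclicProj ζ N φ n * cyclicProj ζ N φ m) x) := fun m =>
      (LinearMap.congr_fun ((hTφ m).cyclicProj_right n).eq (cyclicProj ζ N φ m x)).symm
    rw [ht, map_sum, Finset.sum_eq_single_of_mem n hn, hswap, cyclicProj_mul_self hζ hN hφN]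
    intro m hm hmn
    rw [hswap, cyclicProj_mul_of_ne hζ hφN (Finset.mem_range.1 hm) (Finset.mem_range.1 hn)
      hmn.symm, LinearMap.zero_apply, map_zero]
  calc ‖x‖ = ‖∑ n ∈ Finset.range N, cyclicProj ζ N φ n x‖ := by
        rw [← LinearMap.sum_apply, sum_cyclicProj hζ hN, Module.End.one_apply]
    _ ≤ ∑ n ∈ Finset.range N, ‖cyclicProj ζ N φ n x‖ := norm_sum_le _ _
    _ ≤ ∑ _n ∈ Finset.range N, ‖t‖ := Finset.sum_le_sum fun n hn => by
        rw [← hT n, ← hcomp n hn]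
        exact norm_cyclicProj_apply_le hζ hN hφ n t
    _ = N * ‖t‖ := by simp

lemma isPrimitiveRoot_omegaN {N : ℕ} (hN : 0 < N) : IsPrimitiveRoot (omegaN N) N :=
  Complex.isPrimitiveRoot_exp N hN.ne'

/-- Conjugation `y ↦ U y U*` as a linear endomorphism. -/
def conjEnd (U : H →L[ℂ] H) : Module.End ℂ (H →L[ℂ] H) :=
  LinearMap.mulLeft ℂ U * LinearMap.mulRight ℂ (star U)

lemma conjEnd_pow_apply (U : H →L[ℂ] H) (j : ℕ) (y : H →L[ℂ] H) :
    (conjEnd U ^ j) y = U ^ j * y * star U ^ j := by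
  induction j with
  | zero => simp
  | succ j ih =>
    rw [pow_succ' (conjEnd U), Module.End.mul_apply, ih, pow_succ' U, pow_succ (star U)]
    simp [conjEnd, mul_assoc]

/-- Summing the two-variable Fourier components over the first index leaves the Fourier
component with respect to `U₂`. -/
lemma sum_fourierComp2 {N : ℕ} (hN : 0 < N) (U₁ U₂ x : H →L[ℂ] H) (m : ℕ) :
    ∑ l ∈ Finset.range N, fourierComp2 N U₁ U₂ x l m =
      cyclicProj (omegaN N) N (conjEnd U₂) m x := by
  have hω := isPrimitiveRoot_omegaN hN
  have hω0 : omegaN N ≠ 0 := hω.ne_zero hN.ne'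
  have hN0 : (N : ℂ) ≠ 0 := Nat.cast_ne_zero.2 hN.ne'
  have hphase : ∀ l j₁ j₂ : ℕ, omegaN N ^ (-(j₁ * l + j₂ * m : ℤ)) =
      (((omegaN N)⁻¹) ^ l) ^ j₁ * (((omegaN N)⁻¹) ^ m) ^ j₂ := fun l j₁ j₂ => by
    rw [← pow_mul, ← pow_mul, ← pow_add, inv_pow, zpow_neg, ← zpow_natCast]
    push_cast
    rw [mul_comm (l : ℤ), mul_comm (m : ℤ)]
  have hinner : ∀ j₁ ∈ Finset.range N,
      ∑ l ∈ Finset.range N, ∑ j₂ ∈ Finset.range N, omegaN N ^ (-(j₁ * l + j₂ * m : ℤ)) •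
        (U₁ ^ j₁ * U₂ ^ j₂ * x * (star U₂) ^ j₂ * (star U₁) ^ j₁) =
      (if j₁ = 0 then (N : ℂ) else 0) • ∑ j₂ ∈ Finset.range N, (((omegaN N)⁻¹) ^ m) ^ j₂ •
        (U₁ ^ j₁ * U₂ ^ j₂ * x * (star U₂) ^ j₂ * (star U₁) ^ j₁) := fun j₁ hj₁ => by
    simp only [hphase, mul_smul, ← Finset.smul_sum]
    rw [← Finset.sum_smul, sum_inv_pow_pow hω (Finset.mem_range.1 hj₁)]
  simp only [fourierComp2]
  rw [← Finset.smul_sum, Finset.sum_comm, Finset.sum_congr rfl hinner,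
    Finset.sum_eq_single_of_mem 0 (Finset.mem_range.2 hN) fun j _ hj => by
      rw [if_neg hj, zero_smul]]
  rw [if_pos rfl, smul_smul, cyclicProj, LinearMap.smul_apply, LinearMap.sum_apply]
  congr 1
  · field_simp
  · simp [conjEnd_pow_apply]

/-- The twisting map `τ_k(x) := ∑_{l,m} x_{l,m} U₁^{km}` satisfies
`‖x‖ ≤ N² ‖τ_k(x)‖`; in particular `τ_k` is injective with inverse bounded by `N²`. -/
theorem norm_le_sq_mul_norm_twist
    (N : ℕ) (hN : 0 < N) (k : ℤ)
    (U₁ U₂ : unitary (H →L[ℂ] H))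
    (hcomm : (U₁ : H →L[ℂ] H) * U₂ = (U₂ : H →L[ℂ] H) * U₁)
    (hU₁N : U₁ ^ N = 1) (hU₂N : U₂ ^ N = 1)
    (x : H →L[ℂ] H) :
    ‖x‖ ≤ (N : ℝ) ^ 2 *
      ‖∑ l ∈ Finset.range N, ∑ m ∈ Finset.range N,
          fourierComp2 N (U₁ : H →L[ℂ] H) (U₂ : H →L[ℂ] H) x l m *
            ((U₁ ^ (k * (m : ℤ)) : unitary (H →L[ℂ] H)) : H →L[ℂ] H)‖ := by
  have hφN : conjEnd (U₂ : H →L[ℂ] H) ^ N = 1 := by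
    have h : (U₂ : H →L[ℂ] H) ^ N = 1 := by exact_mod_cast congrArg Subtype.val hU₂N
    ext1 y
    rw [conjEnd_pow_apply, ← star_pow, h, star_one, one_mul, mul_one, Module.End.one_apply]
  have hφ : ∀ y : H →L[ℂ] H, ‖conjEnd (U₂ : H →L[ℂ] H) y‖ = ‖y‖ := fun y => by
    change ‖(U₂ : H →L[ℂ] H) * (y * ((star U₂ : unitary (H →L[ℂ] H)) : H →L[ℂ] H))‖ = ‖y‖
    rw [CStarRing.norm_coe_unitary_mul, CStarRing.norm_mul_coe_unitary]
  have hcommU : Commute U₁ U₂ := Subtype.ext hcomm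
  let T : ℕ → Module.End ℂ (H →L[ℂ] H) := fun m =>
    LinearMap.mulRight ℂ ((U₁ ^ (k * (m : ℤ)) : unitary (H →L[ℂ] H)) : H →L[ℂ] H)
  have hTφ : ∀ m, Commute (T m) (conjEnd (U₂ : H →L[ℂ] H)) := fun m => by
    have h : star U₂ * U₁ ^ (k * (m : ℤ)) = U₁ ^ (k * (m : ℤ)) * star U₂ :=
      ((hcommU.zpow_left (k * (m : ℤ))).inv_right).eq.symm
    ext1 y
    change (U₂ : H →L[ℂ] H) * (y * ((star U₂ : unitary (H →L[ℂ] H)) : H →L[ℂ] H)) *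
        ((U₁ ^ (k * (m : ℤ)) : unitary (H →L[ℂ] H)) : H →L[ℂ] H) =
      (U₂ : H →L[ℂ] H) * ((y * ((U₁ ^ (k * (m : ℤ)) : unitary (H →L[ℂ] H)) : H →L[ℂ] H)) *
        ((star U₂ : unitary (H →L[ℂ] H)) : H →L[ℂ] H))
    rw [mul_assoc, mul_assoc, mul_assoc, ← Submonoid.coe_mul, ← Submonoid.coe_mul, h]
  have hT : ∀ m (y : H →L[ℂ] H), ‖T m y‖ = ‖y‖ := fun m y => CStarRing.norm_mul_coe_unitary _ _
  have hbound := norm_le_mul_norm_sum_comp_cyclicProj (isPrimitiveRoot_omegaN hN) hN hφN hφ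
    hTφ hT x
  have hN1 : (1 : ℝ) ≤ N := Nat.one_le_cast.2 hN
  rw [Finset.sum_comm]
  simp only [← Finset.sum_mul, sum_fourierComp2 hN]
  refine hbound.trans (mul_le_mul_of_nonneg_right ?_ (norm_nonneg _))
  nlinarith
end
end
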